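/- Let r ≥ 0, n ≥ 2 and i ≥ 1 be integers with i ≤ n/2, and let p > 2 be a prime such that p divides the product n(n−1)⋯(n−i+1)·(r+1)(r+2)⋯(r+i). Set u = ν_p(C(n+r, r)) and let z₀ be the integer with 0 ≤ z₀ < p and z₀ ≡ n + r (mod p). If u > 0 and both (u+1)/p < 1/i and (ν_p(n+r−z₀) − ν_p(n))/(z₀+1) < 1/i hold, then 𝓛_n^{⟨r⟩}(x) has no monic factor in ℚ[x] of degree exactly i. -/

import Mathlib

open Polynomial

/-- The monic integer polynomial `𝓛_n^{⟨r⟩}(x) = ∑_{j=0}^{n} C(n,j)·(r+1)⋯(r+n−j)·x^j`,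
viewed as a polynomial over `ℚ`. -/
noncomputable def laguerreL (n r : ℕ) : Polynomial ℚ :=
  ∑ j ∈ Finset.range (n + 1),
    Polynomial.C ((n.choose j : ℚ) * ∏ t ∈ Finset.Icc 1 (n - j), ((r : ℚ) + (t : ℚ))) *
      Polynomial.X ^ j

theorem Multiset.pow_card_lt_norm_prod {K : Type*} [NormedField K] {c : ℝ} (hc : 0 ≤ c)
    (s : Multiset K) (hs : s ≠ 0) (h : ∀ x ∈ s, c < ‖x‖) : c ^ card s < ‖s.prod‖ := by
  induction s using Multiset.induction with
  | empty => exact absurd rfl hs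
  | cons a s ih =>
    have ha := h a (mem_cons_self a s)
    rw [prod_cons, card_cons, norm_mul, pow_succ']
    rcases eq_or_ne s 0 with rfl | hs0
    · simpa using ha
    · exact mul_lt_mul'' ha (ih hs0 fun x hx => h x (mem_cons_of_mem hx)) hc (by positivity)

theorem Polynomial.exists_root_norm_le {K : Type*} [NormedField K] [IsAlgClosed K] {q : K[X]}
    (hq : q.Monic) (hd : q.natDegree ≠ 0) {c : ℝ} (hc : 0 ≤ c)
    (h : ‖q.coeff 0‖ ≤ c ^ q.natDegree) : ∃ α, q.IsRoot α ∧ ‖α‖ ≤ c := by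
  by_contra! H
  have hs := IsAlgClosed.splits q
  have hcard : Multiset.card q.roots = q.natDegree := hs.natDegree_eq_card_roots.symm
  have hlt := q.roots.pow_card_lt_norm_prod hc
    (fun h0 => hd (by rw [← hcard, h0, Multiset.card_zero]))
    fun x hx => H x (isRoot_of_mem_roots hx)
  rw [hs.coeff_zero_eq_prod_roots_of_monic hq, norm_mul, norm_pow, norm_neg, norm_one, one_pow,
    one_mul, ← hcard] at h
  exact absurd h hlt.not_ge

theorem Polynomial.eval_ne_zero_of_norm_lt {K : Type*} [NormedField K] [IsUltrametricDist K]
    {f : K[X]} {α : K} (h : ∀ j, 1 ≤ j → ‖f.coeff j‖ * ‖α‖ ^ j < ‖f.coeff 0‖) :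
    f.eval α ≠ 0 := by
  intro h0
  have hpos : 0 < ‖f.coeff 0‖ := lt_of_le_of_lt (by positivity) (h 1 le_rfl)
  rw [eval_eq_sum_range, Finset.sum_range_succ', pow_zero, mul_one] at h0
  have hlt : ‖∑ j ∈ Finset.range f.natDegree, f.coeff (j + 1) * α ^ (j + 1)‖ < ‖f.coeff 0‖ := by
    refine Finset.sum_induction _ (fun x => ‖x‖ < ‖f.coeff 0‖) (fun a b ha hb => ?_)
      (by simpa using hpos) fun j _ => ?_
    · exact (IsUltrametricDist.norm_add_le_max a b).trans_lt (max_lt ha hb)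
    · simpa only [norm_mul, norm_pow] using h (j + 1) (Nat.le_add_left 1 j)
  rw [eq_neg_of_add_eq_zero_left h0, norm_neg] at hlt
  exact lt_irrefl _ hlt

theorem PadicAlgCl.norm_intCast (p : ℕ) [Fact p.Prime] (z : ℤ) :
    ‖(z : PadicAlgCl p)‖ = ‖(z : ℚ_[p])‖ := by
  rw [← PadicAlgCl.norm_extends, map_intCast]

theorem PadicAlgCl.norm_intCast_eq_pow (p : ℕ) [Fact p.Prime] {z : ℤ} (hz : z ≠ 0) :
    ‖(z : PadicAlgCl p)‖ = ((p : ℝ)⁻¹) ^ padicValInt p z := by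
  rw [norm_intCast, Padic.norm_eq_zpow_neg_valuation (Int.cast_ne_zero.mpr hz),
    Padic.valuation_intCast, zpow_neg, zpow_natCast, inv_pow]

/-- If `f ≡ X ^ (m + 1) * w` modulo a prime, then in any monic factorization `f = g * h` with
`deg h = m` the prime divides the constant coefficient of `g`. -/
theorem Polynomial.prime_dvd_coeff_zero_of_mul {p : ℕ} (hp : p.Prime) {g h : ℤ[X]}
    (hh : h.Monic) (hdiv : ∀ j ≤ h.natDegree, (p : ℤ) ∣ (g * h).coeff j) :
    (p : ℤ) ∣ g.coeff 0 := by
  have := Fact.mk hp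
  by_contra hg0
  set φ := Int.castRingHom (ZMod p)
  have hX : (X : (ZMod p)[X]) ^ (h.natDegree + 1) ∣ g.map φ * h.map φ := by
    rw [X_pow_dvd_iff, ← Polynomial.map_mul]
    intro j hj
    rw [coeff_map, eq_intCast, ZMod.intCast_zmod_eq_zero_iff_dvd]
    exact hdiv j (Nat.lt_succ_iff.mp hj)
  have hXg : ¬ (X : (ZMod p)[X]) ∣ g.map φ := by
    rwa [X_dvd_iff, coeff_map, eq_intCast, ZMod.intCast_zmod_eq_zero_iff_dvd]
  have hXh := prime_X.pow_dvd_of_dvd_mul_left _ hXg hX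
  have := natDegree_le_of_dvd hXh (hh.map φ).ne_zero
  rw [natDegree_X_pow, hh.natDegree_map] at this
  omega

/-- A Newton polygon criterion: if all the slopes of the `p`-adic Newton polygon of `f` are less
than `1 / i`, then the constant coefficient of a monic factor of degree `i` is prime to `p`. -/
theorem Polynomial.not_prime_dvd_coeff_zero_of_dvd {p : ℕ} (hp : p.Prime) {f g : ℤ[X]}
    (hg : g.Monic) (hd : g.natDegree ≠ 0) (hgf : g ∣ f) (hf0 : f.coeff 0 ≠ 0)
    (hslope : ∀ j, 1 ≤ j → f.coeff j ≠ 0 → g.natDegree * padicValInt p (f.coeff 0) <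
      g.natDegree * padicValInt p (f.coeff j) + j) :
    ¬ (p : ℤ) ∣ g.coeff 0 := by
  have := Fact.mk hp
  intro hdvd
  set i := g.natDegree with hi
  have hp0 : (0 : ℝ) < (p : ℝ)⁻¹ := inv_pos.mpr (Nat.cast_pos.mpr hp.pos)
  have hp1 : (p : ℝ)⁻¹ < 1 := inv_lt_one_of_one_lt₀ (by exact_mod_cast hp.one_lt)
  set c : ℝ := (p : ℝ)⁻¹ ^ ((i : ℝ)⁻¹) with hcdef
  have hci : c ^ i = (p : ℝ)⁻¹ := Real.rpow_inv_natCast_pow hp0.le hd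
  have hc0 : 0 < c := Real.rpow_pos_of_pos hp0 _
  have hc1 : c < 1 := Real.rpow_lt_one hp0.le hp1 (by positivity)
  set φ := Int.castRingHom (PadicAlgCl p)
  have hnorm : ‖(g.map φ).coeff 0‖ ≤ c ^ (g.map φ).natDegree := by
    rw [hg.natDegree_map, ← hi, hci, coeff_map, eq_intCast, PadicAlgCl.norm_intCast]
    have := (Padic.norm_int_le_pow_iff_dvd (p := p) (g.coeff 0) 1).mpr (by simpa using hdvd)
    simpa using this
  obtain ⟨α, hα, hαc⟩ := exists_root_norm_le (hg.map φ)
    (by rwa [hg.natDegree_map]) hc0.le hnorm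
  refine eval_ne_zero_of_norm_lt (f := f.map φ) (α := α) (fun j hj => ?_)
    (hα.dvd (Polynomial.map_dvd φ hgf))
  rw [coeff_map, coeff_map, eq_intCast, eq_intCast, PadicAlgCl.norm_intCast_eq_pow p hf0, ← hci,
    ← pow_mul]
  rcases eq_or_ne (f.coeff j) 0 with h0 | h0
  · simp only [h0, Int.cast_zero, norm_zero, zero_mul]
    positivity
  · rw [PadicAlgCl.norm_intCast_eq_pow p h0, ← hci, ← pow_mul]
    calc c ^ (i * padicValInt p (f.coeff j)) * ‖α‖ ^ j
        ≤ c ^ (i * padicValInt p (f.coeff j)) * c ^ j := by gcongr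
      _ = c ^ (i * padicValInt p (f.coeff j) + j) := (pow_add _ _ _).symm
      _ < c ^ (i * padicValInt p (f.coeff 0)) :=
        pow_lt_pow_right_of_lt_one₀ hc0 hc1 (hslope j hj h0)

theorem Finset.prod_Icc_add_eq_factorial_mul_choose (r k : ℕ) :
    ∏ t ∈ Finset.Icc 1 k, (r + t) = k.factorial * (k + r).choose r := by
  induction k with
  | zero => simp
  | succ k ih =>
    rw [Finset.prod_Icc_succ_top (Nat.le_add_left 1 k), ih]
    have h1 := Nat.add_choose_mul_factorial_mul_factorial k r
    have h2 := Nat.add_choose_mul_factorial_mul_factorial (k + 1) r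
    refine Nat.eq_of_mul_eq_mul_right r.factorial_pos ?_
    rw [show k + 1 + r = (k + r) + 1 by ring, Nat.factorial_succ (k + r), ← h1] at h2
    rw [show k + 1 + r = (k + r) + 1 by ring]
    linear_combination -h2

theorem Nat.add_choose_mul_descFactorial {n j : ℕ} (r : ℕ) (hj : j ≤ n) :
    (n + r).choose r * n.descFactorial j = (n - j + r).choose r * (n + r).descFactorial j := by
  have h1 := Nat.add_choose_mul_factorial_mul_factorial n r
  have h2 := Nat.add_choose_mul_factorial_mul_factorial (n - j) r
  have h3 := Nat.factorial_mul_descFactorial hj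
  have h4 := Nat.factorial_mul_descFactorial (hj.trans (Nat.le_add_right n r))
  rw [show n + r - j = n - j + r by omega, ← h1, ← h2, ← h3] at h4
  refine Nat.eq_of_mul_eq_mul_right (Nat.mul_pos (n - j).factorial_pos r.factorial_pos) ?_
  linear_combination -h4

theorem Nat.eq_mod_of_dvd_sub {p N k : ℕ} (hk : k < p) (hkN : k ≤ N) (h : p ∣ N - k) :
    k = N % p := by
  have := (Nat.modEq_iff_dvd' hkN).mpr h
  rwa [Nat.ModEq, Nat.mod_eq_of_lt hk] at this

theorem padicValNat_descFactorial_succ {p N k : ℕ} [Fact p.Prime] (hk : k < N) :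
    padicValNat p (N.descFactorial (k + 1)) =
      padicValNat p (N - k) + padicValNat p (N.descFactorial k) := by
  rw [Nat.descFactorial_succ, padicValNat.mul (Nat.sub_pos_of_lt hk).ne'
    (Nat.descFactorial_pos.mpr hk.le).ne']

theorem padicValNat_descFactorial_eq_zero {p N j : ℕ} [hp : Fact p.Prime] (hj : j ≤ N % p) :
    padicValNat p (N.descFactorial j) = 0 := by
  have hmN := Nat.mod_le N p
  have hmp := Nat.mod_lt N hp.out.pos
  induction j with
  | zero => simp
  | succ k ih =>
    rw [padicValNat_descFactorial_succ (by omega), ih (by omega), add_zero]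
    refine padicValNat.eq_zero_of_not_dvd fun h => ?_
    have := Nat.eq_mod_of_dvd_sub (by omega) (by omega) h
    omega

theorem padicValNat_descFactorial_of_mod_lt {p N j : ℕ} [hp : Fact p.Prime] (hj : N % p < j)
    (hjp : j ≤ p) (hjN : j ≤ N) :
    padicValNat p (N.descFactorial j) = padicValNat p (N - N % p) := by
  induction j, hj using Nat.le_induction with
  | base =>
    rw [padicValNat_descFactorial_succ (by omega), padicValNat_descFactorial_eq_zero le_rfl,
      add_zero]
  | succ k hk ih =>
    rw [padicValNat_descFactorial_succ (by omega), ih (by omega) (by omega), Nat.add_eq_right]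
    refine padicValNat.eq_zero_of_not_dvd fun h => ?_
    have := Nat.eq_mod_of_dvd_sub (by omega) (by omega) h
    omega

theorem padicValNat_choose_slope {p n r i j u : ℕ} (hp : p.Prime)
    (hu : u = padicValNat p ((n + r).choose r)) (h1 : i * (u + 1) < p)
    (h2 : i * padicValNat p (n + r - (n + r) % p) < i * padicValNat p n + ((n + r) % p + 1))
    (hj1 : 1 ≤ j) (hjn : j ≤ n) :
    i * (u + padicValNat p j.factorial) < i * padicValNat p ((n - j + r).choose r) + j := by
  have := Fact.mk hp
  rcases le_or_gt p j with hpj | hjp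
  · have hV := sub_one_mul_padicValNat_factorial_lt_of_ne_zero p (n := j) (by omega)
    obtain ⟨q, rfl⟩ : ∃ q, p = q + 1 := ⟨p - 1, by have := hp.pos; omega⟩
    rw [Nat.add_sub_cancel] at hV
    generalize padicValNat (q + 1) j.factorial = V at *
    have hiu : i * u + i ≤ q := by linarith
    have hq : 0 < q := by have := hp.two_le; omega
    suffices i * (u + V) < j by omega
    refine lt_of_mul_lt_mul_left (a := q) ?_ hq.le
    obtain ⟨a, rfl⟩ := Nat.exists_eq_add_of_le hiu
    obtain ⟨b, rfl⟩ := Nat.exists_eq_add_of_le hpj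
    set q := i * u + i + a
    have e1 : i * (q * V) ≤ i * (q + b) := Nat.mul_le_mul_left i (by omega)
    have e2 : i * b ≤ q * b := Nat.mul_le_mul_right b (by omega)
    have e3 : q * (i * u + i) ≤ q * q := Nat.mul_le_mul_left q (by omega)
    linarith
  · have hfac : padicValNat p j.factorial = 0 := padicValNat.eq_zero_of_not_dvd fun h =>
      absurd ((hp.dvd_factorial).mp h) hjp.not_ge
    have hv := congrArg (padicValNat p) (Nat.add_choose_mul_descFactorial r hjn)
    have hpos : n.descFactorial j ≠ 0 := (Nat.descFactorial_pos.mpr hjn).ne'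
    rw [padicValNat.mul (Nat.choose_pos (by omega)).ne' hpos, ← hu,
      padicValNat.mul (Nat.choose_pos (by omega)).ne'
        (Nat.descFactorial_pos.mpr (by omega)).ne'] at hv
    rw [hfac, add_zero]
    rcases le_or_gt j ((n + r) % p) with hjz | hjz
    · rw [padicValNat_descFactorial_eq_zero hjz] at hv
      have : i * u ≤ i * padicValNat p ((n - j + r).choose r) := Nat.mul_le_mul_left i (by omega)
      omega
    · rw [padicValNat_descFactorial_of_mod_lt hjz hjp.le (by omega)] at hv
      have hdvd : n ∣ n.descFactorial j := by
        obtain ⟨k, rfl⟩ := Nat.exists_eq_add_of_le' hj1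
        obtain ⟨m, rfl⟩ := Nat.exists_eq_add_of_le' (hj1.trans hjn)
        exact ⟨_, Nat.succ_descFactorial_succ m k⟩
      have hle : padicValNat p n ≤ padicValNat p (n.descFactorial j) :=
        (padicValNat_dvd_iff_le hpos).mp (pow_padicValNat_dvd.trans hdvd)
      have hmul := congrArg (i * ·) hv
      simp only [mul_add] at hmul
      have := Nat.mul_le_mul_left i hle
      omega

/-- The coefficients of `laguerreL`, as natural numbers. -/
def laguerreCoeff (n r j : ℕ) : ℕ := n.choose j * ∏ t ∈ Finset.Icc 1 (n - j), (r + t)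

/-- The polynomial `laguerreL` over the integers. -/
noncomputable def laguerreInt (n r : ℕ) : ℤ[X] :=
  ∑ j ∈ Finset.range (n + 1), C (laguerreCoeff n r j : ℤ) * X ^ j

theorem laguerreCoeff_self (n r : ℕ) : laguerreCoeff n r n = 1 := by
  simp [laguerreCoeff]

theorem laguerreCoeff_of_lt {n j : ℕ} (r : ℕ) (hj : n < j) : laguerreCoeff n r j = 0 := by
  simp [laguerreCoeff, Nat.choose_eq_zero_of_lt hj]

theorem laguerreCoeff_ne_zero {n j : ℕ} (r : ℕ) (hj : j ≤ n) : laguerreCoeff n r j ≠ 0 := by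
  refine mul_ne_zero (Nat.choose_pos hj).ne' (Finset.prod_ne_zero_iff.mpr fun t ht => ?_)
  have := (Finset.mem_Icc.mp ht).1
  omega

theorem laguerreCoeff_eq_descFactorial_mul {n j : ℕ} (r : ℕ) (hj : j ≤ n) :
    laguerreCoeff n r j = n.descFactorial (n - j) * (n - j + r).choose r := by
  rw [laguerreCoeff, Finset.prod_Icc_add_eq_factorial_mul_choose,
    Nat.descFactorial_eq_factorial_mul_choose, Nat.choose_symm hj]
  ring

theorem laguerreCoeff_mul_factorial {n j : ℕ} (r : ℕ) (hj : j ≤ n) :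
    laguerreCoeff n r j * j.factorial = n.factorial * (n - j + r).choose r := by
  have := Nat.factorial_mul_descFactorial (Nat.sub_le n j)
  rw [Nat.sub_sub_self hj] at this
  rw [laguerreCoeff_eq_descFactorial_mul r hj, ← this]
  ring

theorem dvd_laguerreCoeff {p n r i j : ℕ} (hp : p.Prime)
    (h : p ∣ (∏ s ∈ Finset.range i, (n - s)) * ∏ t ∈ Finset.Icc 1 i, (r + t))
    (hij : i + j ≤ n) : p ∣ laguerreCoeff n r j := by
  rcases hp.dvd_mul.mp h with h | h
  · rw [laguerreCoeff_eq_descFactorial_mul r (by omega), Nat.descFactorial_eq_prod_range]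
    refine (h.trans (Finset.prod_dvd_prod_of_subset _ _ _ ?_)).mul_right _
    exact Finset.range_subset_range.mpr (by omega)
  · refine (h.trans (Finset.prod_dvd_prod_of_subset _ _ _ ?_)).mul_left _
    exact Finset.Icc_subset_Icc_right (by omega)

theorem laguerreInt_coeff (n r j : ℕ) : (laguerreInt n r).coeff j = laguerreCoeff n r j := by
  simp only [laguerreInt, finsetSum_coeff, coeff_C_mul_X_pow, Finset.sum_ite_eq,
    Finset.mem_range]
  split_ifs with h
  · rfl
  · rw [laguerreCoeff_of_lt r (by omega), Nat.cast_zero]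

theorem laguerreInt_natDegree_le (n r : ℕ) : (laguerreInt n r).natDegree ≤ n := by
  refine natDegree_le_iff_coeff_eq_zero.mpr fun j hj => ?_
  rw [laguerreInt_coeff, laguerreCoeff_of_lt r hj, Nat.cast_zero]

theorem laguerreInt_monic (n r : ℕ) : (laguerreInt n r).Monic := by
  refine monic_of_natDegree_le_of_coeff_eq_one n (laguerreInt_natDegree_le n r) ?_
  rw [laguerreInt_coeff, laguerreCoeff_self, Nat.cast_one]

theorem laguerreInt_natDegree (n r : ℕ) : (laguerreInt n r).natDegree = n := by
  refine natDegree_eq_of_le_of_coeff_ne_zero (laguerreInt_natDegree_le n r) ?_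
  rw [laguerreInt_coeff, laguerreCoeff_self, Nat.cast_one]
  exact one_ne_zero

theorem laguerreInt_map (n r : ℕ) :
    (laguerreInt n r).map (algebraMap ℤ ℚ) = laguerreL n r := by
  rw [laguerreInt, laguerreL, Polynomial.map_sum]
  refine Finset.sum_congr rfl fun j _ => ?_
  rw [Polynomial.map_mul, map_C, Polynomial.map_pow, map_X, laguerreCoeff]
  simp only [eq_intCast, Int.cast_natCast]
  push_cast
  rfl

theorem laguerreInt_slope {p n r i j u : ℕ} (hp : p.Prime)
    (hu : u = padicValNat p ((n + r).choose r)) (h1 : i * (u + 1) < p)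
    (h2 : i * padicValNat p (n + r - (n + r) % p) < i * padicValNat p n + ((n + r) % p + 1))
    (hj1 : 1 ≤ j) (hjn : j ≤ n) :
    i * padicValNat p (laguerreCoeff n r 0) < i * padicValNat p (laguerreCoeff n r j) + j := by
  have := Fact.mk hp
  have key := padicValNat_choose_slope hp hu h1 h2 hj1 hjn
  have e0 := congrArg (padicValNat p) (laguerreCoeff_mul_factorial r n.zero_le)
  have ej := congrArg (padicValNat p) (laguerreCoeff_mul_factorial r hjn)
  rw [Nat.factorial_zero, mul_one, Nat.sub_zero, padicValNat.mul n.factorial_ne_zero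
    (Nat.choose_pos (by omega)).ne', ← hu] at e0
  rw [padicValNat.mul (laguerreCoeff_ne_zero r hjn) j.factorial_ne_zero,
    padicValNat.mul n.factorial_ne_zero (Nat.choose_pos (by omega)).ne'] at ej
  rw [e0]
  have := congrArg (i * ·) ej
  simp only [mul_add] at this key ⊢
  omega

theorem laguerre_no_factor_of_degree_eq' (n r i : ℕ) (hn : 2 ≤ n) (hi : 1 ≤ i) (hi2 : 2 * i ≤ n)
    (p : ℕ) (hp : p.Prime) (hp2 : 2 < p)
    (hdvd : p ∣ (∏ s ∈ Finset.range i, (n - s)) * ∏ t ∈ Finset.Icc 1 i, (r + t))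
    (u : ℕ) (hu : u = padicValNat p ((n + r).choose r)) (hu0 : 0 < u)
    (z₀ : ℕ) (hz : z₀ = (n + r) % p)
    (h1 : ((u : ℚ) + 1) / (p : ℚ) < 1 / (i : ℚ))
    (h2 : ((padicValNat p (n + r - z₀) : ℚ) - (padicValNat p n : ℚ)) / ((z₀ : ℚ) + 1)
            < 1 / (i : ℚ)) :
    ¬ ∃ g : Polynomial ℚ, g.Monic ∧ g ∣ laguerreL n r ∧ g.natDegree = i := by
  rintro ⟨g, hg, hgL, hgi⟩
  rw [← laguerreInt_map] at hgL
  have hF := laguerreInt_monic n r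
  obtain ⟨g', hgg⟩ := IsIntegrallyClosed.eq_map_mul_C_of_dvd ℚ hF hgL
  rw [hg.leadingCoeff, C_1, mul_one] at hgg
  subst hgg
  have hg' : g'.Monic := monic_of_injective (algebraMap ℤ ℚ).injective_int hg
  rw [hg'.natDegree_map] at hgi
  have hdvdF : g' ∣ laguerreInt n r := hF.dvd_of_fraction_map_dvd_fraction_map hg' hgL
  have hi0 : (0 : ℚ) < i := by exact_mod_cast hi
  rw [div_lt_div_iff₀ (by exact_mod_cast hp.pos) hi0] at h1
  rw [div_lt_div_iff₀ (by positivity) hi0] at h2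
  have h1' : i * (u + 1) < p := by
    rw [← Nat.cast_lt (α := ℚ)]
    push_cast
    linarith
  have h2' : i * padicValNat p (n + r - (n + r) % p) <
      i * padicValNat p n + ((n + r) % p + 1) := by
    rw [← hz, ← Nat.cast_lt (α := ℚ)]
    push_cast
    linarith
  refine not_prime_dvd_coeff_zero_of_dvd hp hg' (by omega) hdvdF ?_ (fun j hj hj0 => ?_) ?_
  · rw [laguerreInt_coeff]
    exact_mod_cast laguerreCoeff_ne_zero r n.zero_le
  · have hjn : j ≤ n := by
      by_contra hlt
      rw [laguerreInt_coeff, laguerreCoeff_of_lt r (by omega)] at hj0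
      exact hj0 rfl
    rw [laguerreInt_coeff, laguerreInt_coeff, padicValInt.of_nat, padicValInt.of_nat, hgi]
    exact laguerreInt_slope hp hu h1' h2' hj hjn
  · obtain ⟨h, hh⟩ := hdvdF
    have hhm : h.Monic := hg'.of_mul_monic_left (hh ▸ hF)
    have hdeg := congrArg natDegree hh
    rw [laguerreInt_natDegree, hg'.natDegree_mul hhm, hgi] at hdeg
    refine prime_dvd_coeff_zero_of_mul hp hhm fun j hj => ?_
    rw [← hh, laguerreInt_coeff]
    exact_mod_cast dvd_laguerreCoeff hp hdvd (by omega)
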